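/- arXiv:1104.0920 — 2 statements merged into one kernel-verified Lean document; each statement's English description precedes it below -/
import Mathlib

section
/- Let n and Δ be integers with 2 ≤ Δ ≤ n−1, and let T be a tree on n vertices with maximum vertex degree Δ. Then H(T) ≥ H(B_{n,Δ}), with equality if and only if T is isomorphic to the broom B_{n,Δ}; that is, among all trees on n vertices with maximum degree Δ, the broom B_{n,Δ} is the unique tree with minimal Harary index. -/
open Finset SimpleGraph

open Classical in
/-- The Harary index: half the sum, over ordered pairs of distinct vertices, of the
reciprocal of the shortest-path distance (so each unordered pair is counted once). -/
noncomputable def harary {V : Type*} [Fintype V] (G : SimpleGraph V) : ℝ :=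
  (∑ u : V, ∑ v : V, if u = v then 0 else (1 : ℝ) / (G.dist u v)) / 2

/-- The path graph `P_n` on `n` vertices. -/
def pathG (n : ℕ) : SimpleGraph (Fin n) :=
  SimpleGraph.fromRel (fun x y => (y : ℕ) = (x : ℕ) + 1)

/-- The star graph `S_n` on `n` vertices, with center `0`. -/
def starG (n : ℕ) : SimpleGraph (Fin n) :=
  SimpleGraph.fromRel (fun x y => (x : ℕ) = 0 ∧ (y : ℕ) ≠ 0)

/-- The spider (starlike tree) `S(L 0, …, L (k-1))`: a center `none` together with `k`
disjoint paths, the `i`-th having `L i` vertices, the center joined to vertex `0` of each leg. -/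
def spider {k : ℕ} (L : Fin k → ℕ) : SimpleGraph (Option (Σ i : Fin k, Fin (L i))) :=
  SimpleGraph.fromRel (fun x y =>
    (∃ (i : Fin k) (j : Fin (L i)), x = none ∧ y = some ⟨i, j⟩ ∧ (j : ℕ) = 0) ∨
    (∃ (i : Fin k) (j j' : Fin (L i)),
      x = some ⟨i, j⟩ ∧ y = some ⟨i, j'⟩ ∧ (j' : ℕ) = (j : ℕ) + 1))

/-- Leg lengths of the balanced starlike tree `BS n k`: the legs sum to `n - 1` and
pairwise differ by at most `1`. -/
def balancedLegs (n k : ℕ) : Fin k → ℕ :=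
  fun i => (n - 1) / k + if (i : ℕ) < (n - 1) % k then 1 else 0

/-- The balanced starlike tree `BS_{n,k}` on `n` vertices with `k` legs of almost equal length. -/
def BS (n k : ℕ) : SimpleGraph (Option (Σ i : Fin k, Fin (balancedLegs n k i))) :=
  spider (balancedLegs n k)

/-- Leg lengths of the broom `B_{n,k}`: one leg with `n - k` vertices, `k - 1` legs with one. -/
def broomLegs (n k : ℕ) : Fin k → ℕ := fun i => if (i : ℕ) = 0 then n - k else 1

/-- The broom `B_{n,k} = S(n-k, 1, …, 1)`. -/
def broom (n k : ℕ) : SimpleGraph (Option (Σ i : Fin k, Fin (broomLegs n k i))) :=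
  spider (broomLegs n k)

/-- Leg lengths of the spur `A_{n,m}`: `n - m - 1` legs with two vertices, the rest with one. -/
def spurLegs (n m : ℕ) : Fin m → ℕ := fun i => if (i : ℕ) < n - m - 1 then 2 else 1

/-- The spur `A_{n,m}`: the star `S_{m+1}` with a pendent edge attached to `n - m - 1`
of its pendent vertices. -/
def spur (n m : ℕ) : SimpleGraph (Option (Σ i : Fin m, Fin (spurLegs n m i))) :=
  spider (spurLegs n m)

/-- The caterpillar `C_{n,d,i}`: a path `v_0 v_1 … v_d` with `n - d - 1` pendent
vertices attached at `v_i`. -/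
def caterpillar (n d i : ℕ) : SimpleGraph (Fin (d + 1) ⊕ Fin (n - d - 1)) :=
  SimpleGraph.fromRel (fun x y =>
    (∃ a b : Fin (d + 1), x = Sum.inl a ∧ y = Sum.inl b ∧ (b : ℕ) = (a : ℕ) + 1) ∨
    (∃ (a : Fin (d + 1)) (p : Fin (n - d - 1)), (a : ℕ) = i ∧ x = Sum.inl a ∧ y = Sum.inr p))

/-- Degree of a vertex. -/
noncomputable def deg {V : Type*} [Fintype V] (G : SimpleGraph V) (v : V) : ℕ :=
  (G.neighborSet v).ncard

/-- Eccentricity of a vertex: the maximum distance to another vertex. -/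
noncomputable def ecc {V : Type*} [Fintype V] (G : SimpleGraph V) (v : V) : ℕ :=
  Finset.univ.sup fun u => G.dist v u

/-- Diameter of a graph: the maximum eccentricity. -/
noncomputable def graphDiam {V : Type*} [Fintype V] (G : SimpleGraph V) : ℕ :=
  Finset.univ.sup fun v => ecc G v

/-- Radius of a graph: the minimum eccentricity. -/
noncomputable def graphRadius {V : Type*} [Fintype V] (G : SimpleGraph V) : ℕ :=
  sInf (Set.range fun v => ecc G v)

/-- Matching number: the maximum cardinality of a set of pairwise non-incident edges. -/
noncomputable def matchingNumber {V : Type*} [Fintype V] (G : SimpleGraph V) : ℕ :=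
  sSup {k | ∃ M : Finset (Sym2 V), M.card = k ∧ (∀ e ∈ M, e ∈ G.edgeSet) ∧
    ∀ e ∈ M, ∀ f ∈ M, e ≠ f → ∀ v : V, ¬(v ∈ e ∧ v ∈ f)}

/-- Independence number: the maximum cardinality of a set of pairwise non-adjacent vertices. -/
noncomputable def indepNum {V : Type*} [Fintype V] (G : SimpleGraph V) : ℕ :=
  sSup {k | ∃ s : Finset V, s.card = k ∧ ∀ u ∈ s, ∀ v ∈ s, u ≠ v → ¬ G.Adj u v}



section Metric

variable {V W : Type*} {G : SimpleGraph V} {G' : SimpleGraph W}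

/-- A vertex at distance `k + 1` from `w` has a neighbour at distance `k` from `w`. -/
theorem exists_adj_dist_eq_of_dist_eq_succ (hG : G.Connected) {w u : V} {k : ℕ}
    (h : G.dist w u = k + 1) : ∃ x, G.Adj x u ∧ G.dist w x = k := by
  obtain ⟨p, hp⟩ := hG.exists_walk_length_eq_dist u w
  cases p with
  | nil => simp at h
  | @cons _ x _ hadj q =>
    refine ⟨x, hadj.symm, ?_⟩
    rw [dist_comm, h, Walk.length_cons] at hp
    have h₁ : G.dist x w ≤ q.length := dist_le q
    have h₂ := hG.dist_triangle (u := u) (v := x) (w := w)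
    rw [dist_eq_one_iff_adj.mpr hadj, dist_comm (v := w), h] at h₂
    rw [dist_comm]
    omega

theorem exists_dist_eq_of_le (hG : G.Connected) {w u : V} {k : ℕ} (h : k ≤ G.dist w u) :
    ∃ x, G.dist w x = k := by
  induction h using Nat.decreasingInduction with
  | self => exact ⟨u, rfl⟩
  | of_succ k _ ih =>
    obtain ⟨x, hx⟩ := ih
    obtain ⟨y, -, hy⟩ := exists_adj_dist_eq_of_dist_eq_succ hG hx
    exact ⟨y, hy⟩

/-- A map sending every edge to an edge or to a single vertex does not lengthen walks. -/
theorem exists_walk_length_le_of_map (f : V → W)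
    (hf : ∀ a b, G.Adj a b → f a = f b ∨ G'.Adj (f a) (f b)) {u v : V} (p : G.Walk u v) :
    ∃ q : G'.Walk (f u) (f v), q.length ≤ p.length := by
  induction p with
  | nil => exact ⟨.nil, le_rfl⟩
  | cons h p ih =>
    obtain ⟨q, hq⟩ := ih
    rw [Walk.length_cons]
    rcases hf _ _ h with heq | hadj
    · exact ⟨q.copy heq.symm rfl, by rw [Walk.length_copy]; omega⟩
    · exact ⟨.cons hadj q, by rw [Walk.length_cons]; omega⟩

theorem dist_map_le (hG : G.Connected) (f : V → W)
    (hf : ∀ a b, G.Adj a b → f a = f b ∨ G'.Adj (f a) (f b)) (u v : V) :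
    G'.dist (f u) (f v) ≤ G.dist u v := by
  obtain ⟨p, hp⟩ := hG.exists_walk_length_eq_dist u v
  obtain ⟨q, hq⟩ := exists_walk_length_le_of_map f hf p
  exact (dist_le q).trans (hq.trans hp.le)

theorem dist_iso (hG : G.Connected) (e : G ≃g G') (u v : V) :
    G'.dist (e u) (e v) = G.dist u v := by
  refine le_antisymm (dist_map_le hG e (fun a b h => .inr (e.map_adj_iff.mpr h)) u v) ?_
  have hG' : G'.Connected := e.connected_iff.mp hG
  simpa using dist_map_le hG' e.symm (fun a b h => .inr (e.symm.map_adj_iff.mpr h)) (e u) (e v)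

theorem harary_eq_of_iso [Fintype V] [Fintype W] (hG : G.Connected) (e : G ≃g G') :
    harary G = harary G' := by
  unfold harary
  congr 1
  refine Fintype.sum_equiv e.toEquiv _ _ fun u => Fintype.sum_equiv e.toEquiv _ _ fun v => ?_
  have hd := dist_iso hG e u v
  rcases eq_or_ne u v with rfl | huv
  · simp
  · have he : e u ≠ e v := e.injective.ne huv
    simp [huv, he, hd]

/-- Deleting a vertex without changing the other distances removes exactly the reciprocal
distances to that vertex from the Harary index. -/
theorem harary_eq_induce_compl_add [Fintype V] [DecidableEq V] (w : V)
    [Fintype ({w}ᶜ : Set V)]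
    (hd : ∀ u v : ({w}ᶜ : Set V), (G.induce {w}ᶜ).dist u v = G.dist u v) :
    harary G = harary (G.induce {w}ᶜ) + ∑ u ∈ {w}ᶜ, (1 : ℝ) / G.dist w u := by
  have hsub : ∀ f : V → ℝ, ∑ u ∈ ({w}ᶜ : Finset V), f u = ∑ u : ({w}ᶜ : Set V), f u :=
    fun f => Finset.sum_subtype _ (by simp) f
  have hw : ∀ u : ({w}ᶜ : Set V), (u : V) ≠ w := fun u => u.2
  unfold harary
  rw [hsub]
  simp only [Fintype.sum_eq_add_sum_compl w, hsub, hd, Finset.sum_add_distrib, hw, (hw _).symm,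
    if_true, if_false, Subtype.ext_iff, dist_comm (u := w)]
  ring_nf

/-- Distances in a connected induced subgraph of an acyclic graph are those of the graph. -/
theorem dist_induce_eq_of_isAcyclic (hG : G.IsAcyclic) {s : Set V} (hs : (G.induce s).Connected)
    (u v : s) : (G.induce s).dist u v = G.dist u v := by
  obtain ⟨p, hp, hlen⟩ := hs.exists_path_of_dist u v
  have hp' := hp.map (f := (Embedding.induce (G := G) s).toHom) Subtype.val_injective
  obtain ⟨q, hq, hqlen⟩ := (Reachable.exists_path_of_dist ⟨p.map (Embedding.induce s).toHom⟩ :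
    ∃ q : G.Walk (u : V) v, q.IsPath ∧ q.length = G.dist u v)
  have := congrArg (fun r => (Subtype.val r).length)
    ((hG.subsingleton_path _ _).elim ⟨q, hq⟩ ⟨_, hp'⟩)
  exact hlen.symm.trans ((Walk.length_map _ _).symm.trans (this.symm.trans hqlen))

/-- Deleting a vertex at maximal distance from `v` keeps the graph connected. -/
theorem connected_induce_compl_of_dist_le (hG : G.Connected) {v w : V} (hvw : v ≠ w)
    (hmax : ∀ u, G.dist v u ≤ G.dist v w) : (G.induce {w}ᶜ).Connected := by
  have key : ∀ k (u : ({w}ᶜ : Set V)), G.dist v u = k →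
      (G.induce {w}ᶜ).Reachable ⟨v, hvw⟩ u := by
    intro k
    induction k with
    | zero =>
      rintro ⟨u, hu⟩ h
      obtain rfl := (hG.dist_eq_zero_iff).mp h
      rfl
    | succ k ih =>
      rintro ⟨u, hu⟩ h
      obtain ⟨x, hadj, hx⟩ := exists_adj_dist_eq_of_dist_eq_succ hG h
      have hxw : x ≠ w := by
        rintro rfl
        have := hmax u
        simp only at h
        omega
      exact (ih ⟨x, hxw⟩ hx).trans (Adj.reachable (by simpa using hadj))
  exact (connected_iff_exists_forall_reachable _).mpr ⟨⟨v, hvw⟩, fun u => key _ u rfl⟩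

end Metric

section ReciprocalSum

/-- The least sum of reciprocals of `N` positive integers whose set of values is `{1, …, e}`. -/
noncomputable def minReciprocalSum (N e : ℕ) : ℝ :=
  ∑ k ∈ Finset.Icc 1 e, (1 : ℝ) / k + ((N : ℝ) - e) / e

theorem minReciprocalSum_succ_lt {N e : ℕ} (he : 1 ≤ e) (heN : e < N) :
    minReciprocalSum N (e + 1) < minReciprocalSum N e := by
  unfold minReciprocalSum
  rw [Finset.sum_Icc_succ_top (by omega)]
  have h0 : (0 : ℝ) < e := by exact_mod_cast he
  have h1 : (0 : ℝ) < (N : ℝ) - e := sub_pos.mpr (by exact_mod_cast heN)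
  have : ((N : ℝ) - e) / (e + 1) < ((N : ℝ) - e) / e :=
    div_lt_div_of_pos_left h1 h0 (by linarith)
  push_cast
  have h2 : (1 : ℝ) / (e + 1) + (N - (e + 1)) / (e + 1) = (N - e) / (e + 1) := by ring
  linarith

theorem minReciprocalSum_lt {N e m : ℕ} (he : 1 ≤ e) (hem : e < m) (hmN : m ≤ N) :
    minReciprocalSum N m < minReciprocalSum N e := by
  induction m, hem using Nat.le_induction with
  | base => exact minReciprocalSum_succ_lt he hmN
  | succ m hm ih =>
    exact (minReciprocalSum_succ_lt (by omega) hmN).trans (ih (by omega))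

variable {α : Type*} {s : Finset α} {D : α → ℕ} {e : ℕ}

theorem minReciprocalSum_le_sum (h1 : ∀ a ∈ s, 1 ≤ D a) (he : ∀ a ∈ s, D a ≤ e)
    (hsurj : ∀ k, 1 ≤ k → k ≤ e → ∃ a ∈ s, D a = k) :
    minReciprocalSum #s e ≤ ∑ a ∈ s, (1 : ℝ) / D a ∧
    (∑ a ∈ s, (1 : ℝ) / D a = minReciprocalSum #s e ↔
      ∀ a ∈ s, ∀ b ∈ s, D a = D b → D a < e → a = b) := by
  classical
  have hfib : ∀ k ∈ Finset.Icc 1 e, 1 ≤ #{a ∈ s | D a = k} := by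
    intro k hk
    obtain ⟨a, ha, hak⟩ := hsurj k (Finset.mem_Icc.mp hk).1 (Finset.mem_Icc.mp hk).2
    exact Finset.card_pos.mpr ⟨a, by simp [ha, hak]⟩
  have hsum : ∑ a ∈ s, (1 : ℝ) / D a - minReciprocalSum #s e =
      ∑ k ∈ Finset.Icc 1 e, ((#{a ∈ s | D a = k} : ℝ) - 1) * (1 / k - 1 / e) := by
    have h := Finset.sum_fiberwise_of_maps_to' (s := s) (t := Finset.Icc 1 e) (g := D)
      (fun a ha => Finset.mem_Icc.mpr ⟨h1 a ha, he a ha⟩) (fun k : ℕ => (1 : ℝ) / k - 1 / e)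
    simp only [Finset.sum_const, nsmul_eq_mul, Finset.sum_sub_distrib] at h
    simp only [sub_mul, one_mul, Finset.sum_sub_distrib, h, minReciprocalSum, Finset.sum_const,
      nsmul_eq_mul, Nat.card_Icc, Nat.add_sub_cancel]
    ring
  have hnonneg : ∀ k ∈ Finset.Icc 1 e,
      0 ≤ ((#{a ∈ s | D a = k} : ℝ) - 1) * (1 / k - 1 / e) := by
    intro k hk
    have hk' := Finset.mem_Icc.mp hk
    refine mul_nonneg (sub_nonneg.mpr (by exact_mod_cast hfib k hk)) (sub_nonneg.mpr ?_)
    exact one_div_le_one_div_of_le (by exact_mod_cast hk'.1) (by exact_mod_cast hk'.2)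
  refine ⟨by linarith [Finset.sum_nonneg hnonneg], ?_⟩
  rw [← sub_eq_zero, hsum, Finset.sum_eq_zero_iff_of_nonneg hnonneg]
  constructor
  · intro h a ha b hb hab hlt
    have hne : (1 : ℝ) / D a - 1 / e ≠ 0 := by
      have := one_div_lt_one_div_of_lt (α := ℝ) (a := D a) (b := e)
        (by exact_mod_cast h1 a ha) (by exact_mod_cast hlt)
      exact (sub_pos.mpr this).ne'
    have hc := (mul_eq_zero.mp
      (h (D a) (Finset.mem_Icc.mpr ⟨h1 a ha, he a ha⟩))).resolve_right hne
    have hc : #{x ∈ s | D x = D a} ≤ 1 := by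
      exact_mod_cast (sub_eq_zero.mp hc).le
    exact Finset.card_le_one.mp hc a (by simp [ha]) b (by simp [hb, hab])
  · intro h k hk
    rcases (Finset.mem_Icc.mp hk).2.eq_or_lt with rfl | hlt
    · simp
    · have hc : #{a ∈ s | D a = k} = 1 := by
        refine le_antisymm (Finset.card_le_one.mpr fun a ha b hb => ?_) (hfib k hk)
        rw [Finset.mem_filter] at ha hb
        exact h a ha.1 b hb.1 (ha.2.trans hb.2.symm) (ha.2 ▸ hlt)
      simp [hc]

end ReciprocalSum

section Broom

variable {V W : Type*} {G : SimpleGraph V} {G' : SimpleGraph W}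

/-- `L` exhibits `G` as a broom whose handle starts at level `0`: each level below `m` is a
single vertex, all other vertices have level `m`, and adjacency means consecutive levels. -/
structure IsBroomLevel (G : SimpleGraph V) (L : V → ℕ) (m : ℕ) : Prop where
  le : ∀ u, L u ≤ m
  existsUnique : ∀ i < m, ∃! u, L u = i
  adj_iff : ∀ u v, G.Adj u v ↔ L u = L v + 1 ∨ L v = L u + 1

namespace IsBroomLevel

variable {L : V → ℕ} {L' : W → ℕ} {m : ℕ}

theorem eq_of_level_eq (h : IsBroomLevel G L m) {u v : V} (huv : L u = L v) (hlt : L u < m) :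
    u = v :=
  (h.existsUnique _ hlt).unique rfl huv.symm

theorem card_fiber [Fintype V] (h : IsBroomLevel G L m) {i : ℕ} (hi : i < m) :
    #{u | L u = i} = 1 := by
  obtain ⟨u, hu, huniq⟩ := h.existsUnique i hi
  exact Finset.card_eq_one.mpr ⟨u, by ext v; simpa using ⟨huniq v, fun hv => hv ▸ hu⟩⟩

/-- Brooms with the same handle length and the same number of vertices are isomorphic. -/
theorem nonempty_iso [Fintype V] [Fintype W] (h : IsBroomLevel G L m)
    (h' : IsBroomLevel G' L' m) (hcard : Fintype.card V = Fintype.card W) :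
    Nonempty (G ≃g G') := by
  classical
  have hV : Fintype.card V = ∑ i ∈ Finset.range (m + 1), #{u | L u = i} :=
    Finset.card_eq_sum_card_fiberwise fun u _ => by simpa [Nat.lt_succ_iff] using h.le u
  have hW : Fintype.card W = ∑ i ∈ Finset.range (m + 1), #{u | L' u = i} :=
    Finset.card_eq_sum_card_fiberwise fun u _ => by simpa [Nat.lt_succ_iff] using h'.le u
  rw [Finset.sum_range_succ] at hV hW
  have hsame : ∑ i ∈ Finset.range m, #{u | L u = i} = ∑ i ∈ Finset.range m, #{u | L' u = i} :=
    Finset.sum_congr rfl fun i hi => by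
      rw [h.card_fiber (Finset.mem_range.mp hi), h'.card_fiber (Finset.mem_range.mp hi)]
  have hfib : ∀ i, Fintype.card {u // L u = i} = Fintype.card {u // L' u = i} := by
    intro i
    rw [Fintype.card_subtype, Fintype.card_subtype]
    rcases lt_trichotomy i m with hi | rfl | hi
    · rw [h.card_fiber hi, h'.card_fiber hi]
    · omega
    · rw [Finset.card_eq_zero.mpr, Finset.card_eq_zero.mpr]
      · exact Finset.filter_eq_empty_iff.mpr fun u _ hu => by have := h'.le u; omega
      · exact Finset.filter_eq_empty_iff.mpr fun u _ hu => by have := h.le u; omega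
  let e : V ≃ W := Equiv.ofFiberEquiv fun i => Fintype.equivOfCardEq (hfib i)
  have he : ∀ u, L' (e u) = L u := Equiv.ofFiberEquiv_map _
  exact ⟨⟨e, by intro u v; rw [h.adj_iff, h'.adj_iff, he, he]⟩⟩

theorem exists_walk (h : IsBroomLevel G L m) (hm : 0 < m) {w : V} (hw : L w = 0) (k : ℕ) :
    ∀ u, L u = k → ∃ p : G.Walk w u, p.length = k := by
  induction k with
  | zero =>
    intro u hu
    obtain rfl := h.eq_of_level_eq (hw.trans hu.symm) (by omega)
    exact ⟨.nil, rfl⟩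
  | succ k ih =>
    intro u hu
    have hk : k < m := by have := h.le u; omega
    obtain ⟨x, hx, -⟩ := h.existsUnique k hk
    obtain ⟨p, hp⟩ := ih x hx
    exact ⟨p.concat ((h.adj_iff x u).mpr (by omega)), by simp [hp]⟩

theorem connected (h : IsBroomLevel G L m) (hm : 0 < m) : G.Connected := by
  obtain ⟨w, hw, -⟩ := h.existsUnique 0 hm
  exact (connected_iff_exists_forall_reachable _).mpr
    ⟨w, fun u => (h.exists_walk hm hw _ u rfl).nonempty⟩

theorem level_le_add_length (h : IsBroomLevel G L m) {u v : V} (p : G.Walk u v) :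
    L v ≤ L u + p.length := by
  induction p with
  | nil => simp
  | cons hadj p ih =>
    have := (h.adj_iff _ _).mp hadj
    rw [Walk.length_cons]
    omega

theorem dist_eq_level (h : IsBroomLevel G L m) (hm : 0 < m) {w : V} (hw : L w = 0) (u : V) :
    G.dist w u = L u := by
  obtain ⟨p, hp⟩ := h.exists_walk hm hw _ u rfl
  obtain ⟨q, hq⟩ := (h.connected hm).exists_walk_length_eq_dist w u
  have h₁ := h.level_le_add_length q
  have h₂ := dist_le p
  omega

/-- Deleting the end of the handle shortens the handle of a broom. -/
theorem induce_compl (h : IsBroomLevel G L (m + 1)) {w : V} (hw : L w = 0) :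
    IsBroomLevel (G.induce {w}ᶜ) (fun u => L u - 1) m := by
  have hpos : ∀ u : ({w}ᶜ : Set V), 0 < L u := by
    rintro ⟨u, hu⟩
    by_contra hu0
    exact hu (h.eq_of_level_eq (by simp at hu0; omega) (by simp at hu0; omega))
  refine ⟨fun u => ?_, fun i hi => ?_, fun u v => ?_⟩
  · have := h.le u
    omega
  · obtain ⟨u, hu, huniq⟩ := h.existsUnique (i + 1) (by omega)
    refine ⟨⟨u, ?_⟩, by simp [hu], fun v hv => Subtype.ext (huniq v ?_)⟩
    · rintro rfl
      omega
    · have := hpos v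
      simp only at hv
      omega
  · have hu := hpos u
    have hv := hpos v
    rw [comap_adj, Function.Embedding.subtype_apply, Function.Embedding.subtype_apply, h.adj_iff]
    omega

theorem dist_induce_compl (h : IsBroomLevel G L (m + 1)) (hm : 0 < m) {w : V} (hw : L w = 0)
    (u v : ({w}ᶜ : Set V)) : (G.induce {w}ᶜ).dist u v = G.dist u v := by
  classical
  obtain ⟨x, hx, hxu⟩ := h.existsUnique 1 (by omega)
  have hxw : x ≠ w := by
    rintro rfl
    omega
  have hne : ∀ u : ({w}ᶜ : Set V), (u : V) ≠ w := fun u => u.2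
  refine le_antisymm ?_ (dist_map_le ((h.induce_compl hw).connected hm) Subtype.val
    (fun a b hab => .inr hab) u v)
  let f : V → ({w}ᶜ : Set V) := fun a => if ha : a = w then ⟨x, hxw⟩ else ⟨a, ha⟩
  have key := dist_map_le (G' := G.induce {w}ᶜ) (h.connected (by omega)) f (fun a b hab => by
    have hl := (h.adj_iff a b).mp hab
    by_cases ha : a = w <;> by_cases hb : b = w
    · simp [f, ha, hb]
    · subst ha
      left
      simp [f, hxu b (by omega), hxw]
    · subst hb
      left
      simp [f, hxu a (by omega), hxw]
    · right
      simpa [f, ha, hb] using hab) u v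
  simpa [f, hne] using key

theorem harary_eq [Fintype V] [DecidableEq V] (h : IsBroomLevel G L (m + 1)) (hm : 0 < m)
    (hcard : m + 1 < Fintype.card V) {w : V} (hw : L w = 0) :
    harary G = harary (G.induce {w}ᶜ) + minReciprocalSum (Fintype.card V - 1) (m + 1) := by
  rw [harary_eq_induce_compl_add w (h.dist_induce_compl hm hw)]
  congr 1
  have hpos : ∀ u ∈ ({w}ᶜ : Finset V), 1 ≤ L u := by
    intro u hu
    rw [Finset.mem_compl, Finset.mem_singleton] at hu
    by_contra hu0
    exact hu (h.eq_of_level_eq (by omega) (by omega))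
  have htop : ∃ u, L u = m + 1 := by
    by_contra! hne
    have hinj : Function.Injective fun u => (⟨L u, by
      have := h.le u
      have := hne u
      omega⟩ : Fin (m + 1)) := fun u v huv => by
        simp only [Fin.mk.injEq] at huv
        have := h.le u
        have := hne u
        exact h.eq_of_level_eq huv (by omega)
    have := Fintype.card_le_of_injective _ hinj
    rw [Fintype.card_fin] at this
    omega
  have hcs : #({w}ᶜ : Finset V) = Fintype.card V - 1 := by simp [Finset.card_compl]
  have key := (minReciprocalSum_le_sum (s := {w}ᶜ) hpos (fun u _ => h.le u) (fun k hk hke => by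
    obtain ⟨u, hu⟩ : ∃ u, L u = k := by
      rcases hke.eq_or_lt with rfl | hlt
      · exact htop
      · exact (h.existsUnique k hlt).exists
    refine ⟨u, ?_, hu⟩
    simp only [Finset.mem_compl, Finset.mem_singleton]
    rintro rfl
    omega)).2.mpr (fun a _ b _ hab hlt => h.eq_of_level_eq hab hlt)
  rw [hcs] at key
  rw [← key]
  exact Finset.sum_congr rfl fun u _ => by rw [h.dist_eq_level (by omega) hw]

end IsBroomLevel

theorem spider_adj_none_some {k : ℕ} {L : Fin k → ℕ} (i : Fin k) (j : Fin (L i)) :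
    (spider L).Adj none (some ⟨i, j⟩) ↔ (j : ℕ) = 0 := by
  rw [spider, fromRel_adj]
  constructor
  · rintro ⟨-, (⟨a, b, -, h, hb⟩ | ⟨a, b, c, h, -⟩) | (⟨a, b, h, -⟩ | ⟨a, b, c, -, h, -⟩)⟩
    · cases h
      exact hb
    all_goals cases h
  · exact fun h => ⟨nofun, .inl (.inl ⟨i, j, rfl, rfl, h⟩)⟩

theorem spider_adj_some_some {k : ℕ} {L : Fin k → ℕ} (i i' : Fin k) (j : Fin (L i))
    (j' : Fin (L i')) : (spider L).Adj (some ⟨i, j⟩) (some ⟨i', j'⟩) ↔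
      i = i' ∧ ((j' : ℕ) = j + 1 ∨ (j : ℕ) = j' + 1) := by
  rw [spider, fromRel_adj]
  constructor
  · rintro ⟨-, (⟨a, b, h, -⟩ | ⟨a, b, c, h, h', hbc⟩) | (⟨a, b, h, -⟩ | ⟨a, b, c, h, h', hbc⟩)⟩
    · cases h
    · cases h
      cases h'
      exact ⟨rfl, .inl hbc⟩
    · cases h
    · cases h
      cases h'
      exact ⟨rfl, .inr hbc⟩
  · rintro ⟨rfl, h⟩
    refine ⟨fun heq => ?_, ?_⟩
    · cases heq
      omega
    · exact h.imp (fun h => .inr ⟨i, j, j', rfl, rfl, h⟩) (fun h => .inr ⟨i, j', j, rfl, rfl, h⟩)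

/-- The level function of `broom n k`, counted from the end of the handle. -/
def broomLevel (n k : ℕ) : Option (Σ i : Fin k, Fin (broomLegs n k i)) → ℕ
  | none => n - k
  | some ⟨i, j⟩ => if (i : ℕ) = 0 then n - k - 1 - j else n - k + 1

theorem isBroomLevel_broom {n k : ℕ} (hk : 1 ≤ k) (hn : k + 1 ≤ n) :
    IsBroomLevel (broom n k) (broomLevel n k) (n - k + 1) := by
  have hleg0 : ∀ (i : Fin k) (j : Fin (broomLegs n k i)), (i : ℕ) = 0 → (j : ℕ) < n - k := by
    intro i j hi
    have := j.2
    simpa [broomLegs, hi] using this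
  have hleg : ∀ (i : Fin k) (j : Fin (broomLegs n k i)), (i : ℕ) ≠ 0 → (j : ℕ) = 0 := by
    intro i j hi
    have := j.2
    simpa [broomLegs, hi] using this
  refine ⟨?_, ?_, ?_⟩
  · rintro (_ | ⟨i, j⟩)
    · simp [broomLevel]
    · simp only [broomLevel]
      split_ifs <;> omega
  · intro l hl
    rcases (Nat.lt_succ_iff.mp hl).eq_or_lt with rfl | hlt
    · refine ⟨none, rfl, ?_⟩
      rintro (_ | ⟨i, j⟩) h
      · rfl
      · simp only [broomLevel] at h
        split_ifs at h <;> omega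
    · refine ⟨some ⟨⟨0, hk⟩, ⟨n - k - 1 - l, by simp only [broomLegs, if_true]; omega⟩⟩, ?_, ?_⟩
      · simp only [broomLevel, if_true]
        omega
      · rintro (_ | ⟨i, j⟩) h
        · simp only [broomLevel] at h
          omega
        · simp only [broomLevel] at h
          split_ifs at h with hi
          · obtain rfl : i = ⟨0, hk⟩ := Fin.ext hi
            have := hleg0 _ j rfl
            congr 2
            ext
            simp only
            omega
          · omega
  · rintro (_ | ⟨i, j⟩) (_ | ⟨i', j'⟩)
    · simp
    · rw [broom, spider_adj_none_some]
      have h₁ := hleg0 i' j'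
      have h₂ := hleg i' j'
      simp only [broomLevel]
      split_ifs <;> omega
    · rw [adj_comm, broom, spider_adj_none_some]
      have h₁ := hleg0 i j
      have h₂ := hleg i j
      simp only [broomLevel]
      split_ifs <;> omega
    · rw [broom, spider_adj_some_some, Fin.ext_iff]
      have h₁ := hleg0 i j
      have h₂ := hleg i j
      have h₃ := hleg0 i' j'
      have h₄ := hleg i' j'
      simp only [broomLevel]
      split_ifs <;> omega

theorem card_broom_vertices {n k : ℕ} (hk : 1 ≤ k) (hn : k ≤ n) :
    Fintype.card (Option (Σ i : Fin k, Fin (broomLegs n k i))) = n := by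
  obtain ⟨d, rfl⟩ := Nat.exists_eq_add_of_le' hk
  simp [broomLegs, Fin.sum_univ_succ]
  omega

end Broom

section Tree

variable {V : Type*} {T : SimpleGraph V}

/-- Every distance level from `w` is nonempty, and the neighbours of `v` lie in at most two of
these levels. -/
theorem dist_add_deg_le [Fintype V] (hT : T.IsTree) {v w : V} (hvw : ¬ T.Adj v w) (u : V) :
    T.dist w u + deg T v ≤ Fintype.card V + 1 := by
  classical
  set S : Finset V := {x | T.Adj v x} with hS
  have hdeg : deg T v = #S := by
    rw [deg, ← Set.ncard_coe_finset]
    congr 1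
    ext x
    simp [hS]
  set t := T.dist w v with ht
  have hsub : Finset.Icc 1 (T.dist w u) \ {t - 1, t + 1} ⊆ (insert w S)ᶜ.image (T.dist w) := by
    intro k hk
    simp only [Finset.mem_sdiff, Finset.mem_Icc, Finset.mem_insert, Finset.mem_singleton] at hk
    obtain ⟨x, hx⟩ := exists_dist_eq_of_le hT.connected hk.1.2
    refine Finset.mem_image.mpr ⟨x, ?_, hx⟩
    rw [Finset.mem_compl, Finset.mem_insert]
    rintro (rfl | hxS)
    · rw [SimpleGraph.dist_self] at hx
      omega
    · have hadj : T.Adj v x := by simpa [hS] using hxS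
      have := hT.dist_eq_dist_add_one_of_adj w hadj
      omega
  have h₁ := (Finset.card_le_card hsub).trans Finset.card_image_le
  have h₂ := Finset.le_card_sdiff ({t - 1, t + 1} : Finset ℕ) (Finset.Icc 1 (T.dist w u))
  have h₃ : #({t - 1, t + 1} : Finset ℕ) ≤ 2 := Finset.card_le_two
  have h₄ : #(insert w S) = #S + 1 := Finset.card_insert_of_notMem (by simpa [hS] using hvw)
  have h₅ : #(insert w S) ≤ Fintype.card V := Finset.card_le_univ _
  rw [Finset.card_compl] at h₁
  rw [Nat.card_Icc] at h₂
  omega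

/-- A tree whose distance levels from `w` are single vertices, except for the last one, is a
broom. -/
theorem isBroomLevel_dist (hT : T.IsTree) {w : V} {m : ℕ} (hle : ∀ u, T.dist w u ≤ m)
    (hex : ∃ u, T.dist w u = m) (hinj : ∀ a b, T.dist w a = T.dist w b → T.dist w a < m → a = b) :
    IsBroomLevel T (T.dist w) m := by
  refine ⟨hle, fun i hi => ?_, fun a b => ⟨hT.dist_eq_dist_add_one_of_adj w, ?_⟩⟩
  · obtain ⟨u, rfl⟩ := hex
    obtain ⟨x, hx⟩ := exists_dist_eq_of_le hT.connected hi.le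
    exact ⟨x, hx, fun y hy => hinj y x (hy.trans hx.symm) (by omega)⟩
  · have key : ∀ a b, T.dist w a = T.dist w b + 1 → T.Adj a b := by
      intro a b h
      obtain ⟨x, hadj, hx⟩ := exists_adj_dist_eq_of_dist_eq_succ hT.connected h
      have hxa := hle a
      obtain rfl := hinj x b hx (by omega)
      exact hadj.symm
    rintro (h | h)
    · exact key a b h
    · exact (key b a h).symm

theorem exists_isBroomLevel_of_card_eq [Fintype V] (hT : T.IsTree) {v : V} (hdeg : 2 ≤ deg T v)
    (hcard : Fintype.card V = deg T v + 1) : ∃ L, IsBroomLevel T L 2 := by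
  classical
  have hadj : ∀ x, x ≠ v → T.Adj v x := by
    have hsub : T.neighborSet v ⊆ {v}ᶜ := fun x hx => (T.ne_of_adj hx).symm
    have heq : T.neighborSet v = {v}ᶜ := by
      refine Set.eq_of_subset_of_ncard_le hsub ?_
      rw [Set.ncard_compl, Set.ncard_singleton, Nat.card_eq_fintype_card, hcard]
      exact le_rfl
    intro x hx
    have : x ∈ T.neighborSet v := heq ▸ hx
    exact this
  obtain ⟨w, hw, u, hu, hwu⟩ := (Set.one_lt_ncard (Set.toFinite _)).mp
    (show 1 < (T.neighborSet v).ncard from hdeg)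
  have hwv : T.dist w v = 1 := dist_eq_one_iff_adj.mpr (T.adj_symm hw)
  have hlev : ∀ x, x ≠ v → x ≠ w → T.dist w x = 2 := by
    intro x hxv hxw
    have h₁ := hT.dist_eq_dist_add_one_of_adj w (hadj x hxv)
    have h₂ := hT.connected.pos_dist_of_ne hxw.symm
    omega
  have hww : T.dist w w = 0 := SimpleGraph.dist_self
  refine ⟨_, isBroomLevel_dist hT (w := w) (fun x => ?_)
    ⟨u, hlev u (T.ne_of_adj hu).symm hwu.symm⟩ fun a b hab hlt => ?_⟩
  · by_cases hxv : x = v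
    · subst hxv
      omega
    by_cases hxw : x = w
    · subst hxw
      omega
    exact (hlev x hxv hxw).le
  · by_contra hne
    have ha := hlev a
    have hb := hlev b
    by_cases hav : a = v
    · subst hav
      by_cases hbw : b = w
      · subst hbw
        omega
      · have := hb (Ne.symm hne) hbw
        omega
    · by_cases haw : a = w
      · subst haw
        by_cases hbv : b = v
        · subst hbv
          omega
        · have := hb hbv (Ne.symm hne)
          omega
      · have := ha hav haw
        omega

/-- A tree with a vertex `v` of degree less than `|V| - 1` has a vertex other than `v` and its
neighbours whose deletion leaves a tree. -/
theorem exists_not_adj_connected_induce_compl [Fintype V] (hT : T.Connected) {v : V}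
    (hcard : deg T v + 1 < Fintype.card V) :
    ∃ w, v ≠ w ∧ ¬ T.Adj v w ∧ (T.induce {w}ᶜ).Connected := by
  classical
  obtain ⟨w, -, hw⟩ := Finset.exists_max_image Finset.univ (T.dist v) ⟨v, Finset.mem_univ v⟩
  have hfar : 2 ≤ T.dist v w := by
    by_contra! hlt
    have hsub : (Set.univ : Set V) ⊆ insert v (T.neighborSet v) := by
      intro x _
      have hx := hw x (Finset.mem_univ x)
      by_cases hxv : x = v
      · exact .inl hxv
      · have := hT.pos_dist_of_ne (Ne.symm hxv)
        exact .inr (dist_eq_one_iff_adj.mp (by omega))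
    have h₁ := Set.ncard_le_ncard hsub
    have h₂ := Set.ncard_insert_le v (T.neighborSet v)
    rw [Set.ncard_univ, Nat.card_eq_fintype_card] at h₁
    unfold deg at hcard
    omega
  have hvw : v ≠ w := by
    rintro rfl
    simp at hfar
  refine ⟨w, hvw, fun hadj => ?_, connected_induce_compl_of_dist_le hT hvw
    fun u => hw u (Finset.mem_univ u)⟩
  rw [dist_eq_one_iff_adj.mpr hadj] at hfar
  omega

theorem deg_induce_compl [Fintype V] {v w : V} (hvw : v ≠ w) (hadj : ¬ T.Adj v w)
    [Fintype ({w}ᶜ : Set V)] : deg (T.induce {w}ᶜ) ⟨v, hvw⟩ = deg T v := by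
  unfold deg
  rw [← Set.ncard_image_of_injective _ Subtype.val_injective]
  congr 1
  ext x
  simp only [Set.mem_image, mem_neighborSet, comap_adj, Function.Embedding.subtype_apply]
  constructor
  · rintro ⟨y, hy, rfl⟩
    exact hy
  · intro hx
    refine ⟨⟨x, ?_⟩, hx, rfl⟩
    rintro rfl
    exact hadj hx

theorem harary_broom_succ {n k : ℕ} (hk : 2 ≤ k) (hn : k + 1 ≤ n) :
    harary (broom (n + 1) k) = harary (broom n k) + minReciprocalSum n (n + 1 - k + 1) := by
  classical
  have hB := isBroomLevel_broom (n := n + 1) (k := k) (by omega) (by omega)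
  have hcard := card_broom_vertices (n := n + 1) (k := k) (by omega) (by omega)
  obtain ⟨w, hw, -⟩ := hB.existsUnique 0 (by omega)
  rw [hB.harary_eq (by omega) (by omega) hw, hcard, Nat.add_sub_cancel]
  congr 1
  have hB' := hB.induce_compl hw
  rw [Nat.sub_add_comm (by omega : k ≤ n)] at hB'
  obtain ⟨e⟩ := hB'.nonempty_iso (isBroomLevel_broom (n := n) (k := k) (by omega) hn) (by
    rw [card_broom_vertices (by omega) (by omega), Fintype.card_compl_set, hcard]
    simp)
  exact harary_eq_of_iso (hB'.connected (by omega)) e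

/-- Among the trees on `n` vertices having a vertex of degree `k`, the broom has the least Harary
index, and it is the only such tree. -/
theorem harary_broom_le {n k : ℕ} (hk : 2 ≤ k) (hn : k + 1 ≤ n) :
    ∀ {V : Type*} [Fintype V] {T : SimpleGraph V}, T.IsTree → Fintype.card V = n →
      (∃ v, deg T v = k) → harary (broom n k) ≤ harary T ∧
        (harary T = harary (broom n k) → ∃ L, IsBroomLevel T L (n - k + 1)) := by
  classical
  induction n, hn using Nat.le_induction with
  | base =>
    rintro V _ T hT hcard ⟨v, rfl⟩
    obtain ⟨L, hL⟩ := exists_isBroomLevel_of_card_eq hT hk hcard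
    have hsub : deg T v + 1 - deg T v + 1 = 2 := by omega
    have hB := isBroomLevel_broom (n := deg T v + 1) (k := deg T v) (by omega) le_rfl
    rw [hsub] at hB ⊢
    obtain ⟨e⟩ := hL.nonempty_iso hB
      (by rw [hcard, card_broom_vertices (by omega) (by omega)])
    exact ⟨(harary_eq_of_iso hT.connected e).ge, fun _ => ⟨L, hL⟩⟩
  | succ n hn ih =>
    rintro V _ T hT hcard ⟨v, hv⟩
    obtain ⟨w, hvw, hadj, hconn⟩ :=
      exists_not_adj_connected_induce_compl hT.connected (v := v) (by omega)
    obtain ⟨hle, -⟩ := ih (T := T.induce {w}ᶜ) ⟨hconn, hT.isAcyclic.induce _⟩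
      (by rw [Fintype.card_compl_set, hcard]; simp) ⟨⟨v, hvw⟩, by rw [deg_induce_compl hvw hadj, hv]⟩
    have hdel := harary_eq_induce_compl_add w (dist_induce_eq_of_isAcyclic hT.isAcyclic hconn)
    obtain ⟨u, -, hu⟩ := Finset.exists_max_image Finset.univ (T.dist w) ⟨v, Finset.mem_univ v⟩
    have hecc := dist_add_deg_le hT hadj u
    have hone : 1 ≤ T.dist w u :=
      (hT.connected.pos_dist_of_ne hvw.symm).trans_le (hu v (Finset.mem_univ v))
    have hcs : #({w}ᶜ : Finset V) = n := by simp [Finset.card_compl, hcard]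
    obtain ⟨hsum, hsum_eq⟩ := minReciprocalSum_le_sum (s := {w}ᶜ) (D := T.dist w) (e := T.dist w u)
      (fun x hx => hT.connected.pos_dist_of_ne fun h => by simp [h] at hx)
      (fun x _ => hu x (Finset.mem_univ x)) (fun i hi hile => by
        obtain ⟨x, hx⟩ := exists_dist_eq_of_le hT.connected hile
        refine ⟨x, ?_, hx⟩
        rw [Finset.mem_compl, Finset.mem_singleton]
        rintro rfl
        rw [SimpleGraph.dist_self] at hx
        omega)
    rw [hcs] at hsum hsum_eq
    rw [harary_broom_succ hk hn, hdel]
    rcases (show T.dist w u ≤ n + 1 - k + 1 by omega).eq_or_lt with heq | hlt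
    · rw [heq] at hsum hsum_eq
      refine ⟨add_le_add hle hsum, fun h => ⟨_, isBroomLevel_dist hT (w := w)
        (fun x => heq ▸ hu x (Finset.mem_univ x)) ⟨u, heq⟩ fun a b hab hlt => ?_⟩⟩
      have hinj := hsum_eq.mp (by linarith)
      by_cases ha : a = w
      · subst ha
        rw [SimpleGraph.dist_self] at hab
        exact hT.connected.dist_eq_zero_iff.mp hab.symm
      · refine hinj a (by simpa using ha) b ?_ hab hlt
        rw [Finset.mem_compl, Finset.mem_singleton]
        rintro rfl
        rw [SimpleGraph.dist_self] at hab
        exact ha (hT.connected.dist_eq_zero_iff.mp hab).symm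
    · have := minReciprocalSum_lt (N := n) hone hlt (by omega)
      exact ⟨by linarith, fun h => absurd h (by linarith)⟩

end Tree

theorem harary_max_degree_min {V : Type*} [Fintype V] (T : SimpleGraph V) (hT : T.IsTree)
    (n Δ : ℕ) (h1 : 2 ≤ Δ) (h2 : Δ ≤ n - 1) (hcard : Fintype.card V = n)
    (hub : ∀ v : V, deg T v ≤ Δ) (hmax : ∃ v : V, deg T v = Δ) :
    harary (broom n Δ) ≤ harary T ∧
    (harary T = harary (broom n Δ) ↔ Nonempty (T ≃g broom n Δ)) := by
  have hn : Δ + 1 ≤ n := by omega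
  obtain ⟨hle, heq⟩ := harary_broom_le h1 hn hT hcard hmax
  refine ⟨hle, fun h => ?_, fun ⟨e⟩ => harary_eq_of_iso hT.connected e⟩
  obtain ⟨L, hL⟩ := heq h
  exact hL.nonempty_iso (isBroomLevel_broom (by omega) hn)
    (by rw [hcard, card_broom_vertices (by omega) (by omega)])
end

section
/- Let n ≥ 4 and let T be a tree on n vertices that is not isomorphic to the path P_n. Then H(T) ≥ H(B_{n,3}); that is, the broom B_{n,3} attains the second minimum Harary index among all trees on n vertices. -/
open Finset SimpleGraph

theorem le_card_of_initial_segment {α : Type*} (f : α → ℕ) (s : Finset α)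
    (hseg : ∀ a ∈ s, ∀ j, 0 < j → j ≤ f a → ∃ b ∈ s, f b = j) (a : α) (ha : a ∈ s) :
    f a ≤ #s := by
  have hsub : Finset.Icc 1 (f a) ⊆ s.image f := fun j hj => by
    rw [Finset.mem_Icc] at hj
    exact mem_image.mpr (hseg a ha j hj.1 hj.2)
  simpa using (card_le_card hsub).trans card_image_le

/-- If the positive values of `f` on `s` are closed under passing to smaller positive integers,
then their reciprocals sum up to at least the harmonic number of `#s`. -/
theorem harmonic_le_sum_inv {α : Type*} [DecidableEq α] (f : α → ℕ) (s : Finset α)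
    (hpos : ∀ a ∈ s, 0 < f a)
    (hseg : ∀ a ∈ s, ∀ j, 0 < j → j ≤ f a → ∃ b ∈ s, f b = j) :
    (harmonic #s : ℝ) ≤ ∑ a ∈ s, (1 : ℝ) / f a := by
  induction hm : #s generalizing s with
  | zero => simp [Finset.card_eq_zero.mp hm]
  | succ m ih =>
    obtain ⟨a, ha, hmax⟩ := s.exists_max_image f (Finset.card_pos.mp (by omega))
    have hle : f a ≤ m + 1 := by
      rw [← hm]
      exact le_card_of_initial_segment f s hseg a ha
    have key := ih (s.erase a) (fun b hb => hpos b (mem_of_mem_erase hb))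
      (fun b hb j hj hjb => by
        obtain hlt | heq := hjb.lt_or_eq
        · obtain ⟨c, hc, rfl⟩ := hseg b (mem_of_mem_erase hb) j hj hjb
          refine ⟨c, mem_erase.mpr ⟨?_, hc⟩, rfl⟩
          rintro rfl
          exact absurd (hmax b (mem_of_mem_erase hb)) (by omega)
        · exact ⟨b, hb, heq.symm⟩)
      (by rw [card_erase_of_mem ha, hm]; rfl)
    rw [← Finset.sum_erase_add _ _ ha, harmonic_succ]
    push_cast
    refine add_le_add key ?_
    rw [← one_div]
    have := hpos a ha
    apply one_div_le_one_div_of_le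
    · exact_mod_cast this
    · exact_mod_cast hle

/-- If moreover `f` is not injective on `s`, then all its values are less than `#s`, which
improves the bound. -/
theorem harmonic_add_inv_le_sum_inv {α : Type*} [DecidableEq α] (f : α → ℕ) (s : Finset α) (m : ℕ)
    (hm : #s = m + 1) (hpos : ∀ a ∈ s, 0 < f a)
    (hseg : ∀ a ∈ s, ∀ j, 0 < j → j ≤ f a → ∃ b ∈ s, f b = j)
    (hinj : ∃ x ∈ s, ∃ y ∈ s, x ≠ y ∧ f x = f y) :
    (harmonic m : ℝ) + 1 / m ≤ ∑ a ∈ s, (1 : ℝ) / f a := by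
  obtain ⟨x, hx, y, hy, hxy, hfxy⟩ := hinj
  have hcard : #(s.erase x) = m := by rw [card_erase_of_mem hx, hm]; rfl
  have hseg' : ∀ a ∈ s.erase x, ∀ j, 0 < j → j ≤ f a → ∃ b ∈ s.erase x, f b = j := by
    intro a ha j hj hja
    obtain ⟨b, hb, rfl⟩ := hseg a (mem_of_mem_erase ha) j hj hja
    by_cases hbx : b = x
    · exact ⟨y, mem_erase.mpr ⟨hxy.symm, hy⟩, by rw [hbx, hfxy]⟩
    · exact ⟨b, mem_erase.mpr ⟨hbx, hb⟩, rfl⟩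
  have hle := le_card_of_initial_segment f _ hseg' y (mem_erase.mpr ⟨hxy.symm, hy⟩)
  have hsum := harmonic_le_sum_inv f _ (fun a ha => hpos a (mem_of_mem_erase ha)) hseg'
  rw [hcard] at hle hsum
  rw [← Finset.sum_erase_add _ _ hx, hfxy]
  refine add_le_add hsum (one_div_le_one_div_of_le ?_ ?_)
  · exact_mod_cast hpos y hy
  · exact_mod_cast hle

/-- Twice the Harary index of the broom `B_{k+4,3}`. -/
noncomputable def broomValue : ℕ → ℝ
  | 0 => 9
  | k + 1 => broomValue k + 2 * ((harmonic (k + 3) : ℝ) + 1 / ((k + 3 : ℕ) : ℝ))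

/-- The discrete intermediate value property of a vertex set, for integer-valued functions that
change by at most one along each edge. Vertex sets inducing connected subgraphs have it. -/
def HasIntermediateValues {V : Type*} (G : SimpleGraph V) (s : Finset V) : Prop :=
  ∀ f : V → ℕ, (∀ a b, G.Adj a b → f b ≤ f a + 1) →
    ∀ a ∈ s, ∀ b ∈ s, ∀ m, f a ≤ m → m ≤ f b → ∃ x ∈ s, f x = m

theorem hasIntermediateValues_singleton {V : Type*} (G : SimpleGraph V) (c : V) :
    HasIntermediateValues G {c} := by
  intro f _ a ha b hb m ham hmb
  rw [Finset.mem_singleton] at ha hb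
  subst ha hb
  exact ⟨b, Finset.mem_singleton_self b, le_antisymm ham hmb⟩

theorem HasIntermediateValues.insert {V : Type*} [DecidableEq V] {G : SimpleGraph V}
    {s : Finset V} (hs : HasIntermediateValues G s) {v w : V} (hw : w ∈ s) (hvw : G.Adj v w) :
    HasIntermediateValues G (insert v s) := by
  intro f hf a ha b hb m ham hmb
  by_cases hm : f v = m
  · exact ⟨v, mem_insert_self v s, hm⟩
  have hv₁ := hf _ _ hvw
  have hv₂ := hf _ _ hvw.symm
  suffices h : ∃ x ∈ s, f x = m from
    let ⟨x, hx, hxm⟩ := h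
    ⟨x, mem_insert_of_mem hx, hxm⟩
  rcases mem_insert.mp ha with rfl | has <;> rcases mem_insert.mp hb with rfl | hbs
  · omega
  · exact hs f hf w hw b hbs m (by omega) hmb
  · exact hs f hf a has w hw m ham (by omega)
  · exact hs f hf a has b hbs m ham hmb

theorem dist_le_dist_add_one {V : Type*} {G : SimpleGraph V} (hG : G.Connected) (v a b : V)
    (hab : G.Adj a b) : G.dist v b ≤ G.dist v a + 1 := by
  have := hG.dist_triangle (u := v) (v := a) (w := b)
  rwa [dist_eq_one_iff_adj.mpr hab] at this

/-- Twice the contribution to the Harary index of the pairs of vertices in `s`. -/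
noncomputable def hararyOn {V : Type*} (G : SimpleGraph V) (s : Finset V) : ℝ :=
  ∑ u ∈ s, ∑ v ∈ s, (1 : ℝ) / G.dist u v

theorem harary_eq_hararyOn {V : Type*} [Fintype V] (G : SimpleGraph V) :
    harary G = hararyOn G univ / 2 := by
  unfold harary hararyOn
  congr 1
  refine Finset.sum_congr rfl fun u _ => Finset.sum_congr rfl fun v _ => ?_
  split_ifs with h
  · simp [h]
  · rfl

theorem hararyOn_insert {V : Type*} [DecidableEq V] (G : SimpleGraph V) {s : Finset V} {v : V}
    (hv : v ∉ s) :
    hararyOn G (insert v s) = hararyOn G s + 2 * ∑ u ∈ s, (1 : ℝ) / G.dist v u := by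
  unfold hararyOn
  simp only [Finset.sum_insert hv, Finset.sum_add_distrib, dist_self, Nat.cast_zero, div_zero]
  simp only [G.dist_comm (v := v)]
  ring

/-- The vertices `c, x, y, z` span a claw centred at `c` (possibly with further edges). -/
structure IsClaw {V : Type*} (G : SimpleGraph V) (c x y z : V) : Prop where
  adj_x : G.Adj c x
  adj_y : G.Adj c y
  adj_z : G.Adj c z
  x_ne_y : x ≠ y
  x_ne_z : x ≠ z
  y_ne_z : y ≠ z

theorem half_le_inv_dist_of_common_neighbor {V : Type*} {G : SimpleGraph V}
    (hG : G.Connected) {c a b : V} (ha : G.Adj c a) (hb : G.Adj c b)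
    (hab : a ≠ b) : (1 : ℝ) / 2 ≤ 1 / G.dist a b := by
  have hpos := hG.pos_dist_of_ne hab
  have hle := dist_le_dist_add_one hG a c b hb
  rw [dist_eq_one_iff_adj.mpr ha.symm] at hle
  apply one_div_le_one_div_of_le
  · exact_mod_cast hpos
  · exact_mod_cast hle

section Claw

variable {V : Type*} [DecidableEq V] {G : SimpleGraph V} {c x y z : V}

theorem IsClaw.card_eq (h : IsClaw G c x y z) : #{c, x, y, z} = 4 := by
  have := h.adj_x.ne
  have := h.adj_y.ne
  have := h.adj_z.ne
  simp [*, h.x_ne_y, h.x_ne_z, h.y_ne_z]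

theorem IsClaw.hasIntermediateValues (h : IsClaw G c x y z) :
    HasIntermediateValues G {c, x, y, z} := by
  have hz := (hasIntermediateValues_singleton G c).insert (Finset.mem_singleton_self c)
    h.adj_z.symm
  have hy := hz.insert (w := c) (by simp) h.adj_y.symm
  have hx := hy.insert (w := c) (by simp) h.adj_x.symm
  convert hx using 1
  ext a
  simp only [Finset.mem_insert, Finset.mem_singleton]
  tauto

theorem IsClaw.le_hararyOn (hG : G.Connected) (h : IsClaw G c x y z) :
    9 ≤ hararyOn G {c, x, y, z} := by
  have hx := h.adj_x.ne
  have hy := h.adj_y.ne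
  have hz := h.adj_z.ne
  have hxy := half_le_inv_dist_of_common_neighbor hG h.adj_x h.adj_y h.x_ne_y
  have hxz := half_le_inv_dist_of_common_neighbor hG h.adj_x h.adj_z h.x_ne_z
  have hyz := half_le_inv_dist_of_common_neighbor hG h.adj_y h.adj_z h.y_ne_z
  rw [hararyOn_insert G (by simp [*]), hararyOn_insert G (by simp [h.x_ne_y, h.x_ne_z]),
    hararyOn_insert G (by simp [h.y_ne_z]),
    Finset.sum_pair h.y_ne_z, Finset.sum_insert (by simp [h.x_ne_y, h.x_ne_z]),
    Finset.sum_pair h.y_ne_z]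
  simp only [Finset.sum_singleton, hararyOn, SimpleGraph.dist_self, dist_eq_one_iff_adj.mpr h.adj_x,
    dist_eq_one_iff_adj.mpr h.adj_y, dist_eq_one_iff_adj.mpr h.adj_z]
  norm_num at *
  linarith

/-- The distances from any vertex to the four vertices of a claw are not all distinct, being
within one of the distance to the centre. -/
theorem IsClaw.exists_dist_eq (hG : G.Connected) (h : IsClaw G c x y z) (v : V) :
    ∃ a ∈ ({c, x, y, z} : Finset V), ∃ b ∈ ({c, x, y, z} : Finset V),
      a ≠ b ∧ G.dist v a = G.dist v b := by
  have close : ∀ a, G.Adj c a →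
      G.dist v a ≤ G.dist v c + 1 ∧ G.dist v c ≤ G.dist v a + 1 := fun a ha =>
    ⟨dist_le_dist_add_one hG v c a ha, dist_le_dist_add_one hG v a c ha.symm⟩
  have hx := close x h.adj_x
  have hy := close y h.adj_y
  have hz := close z h.adj_z
  refine exists_ne_map_eq_of_card_lt_of_maps_to
    (t := Finset.Icc (G.dist v c - 1) (G.dist v c + 1)) ?_ ?_
  · rw [h.card_eq, Nat.card_Icc]
    omega
  · intro a ha
    simp only [Finset.coe_insert, Finset.coe_singleton, Set.mem_insert_iff,
      Set.mem_singleton_iff] at ha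
    rw [Finset.mem_coe, Finset.mem_Icc]
    rcases ha with rfl | rfl | rfl | rfl <;> omega

theorem IsClaw.harmonic_le_sum_inv_dist (hG : G.Connected) (h : IsClaw G c x y z) {s : Finset V}
    (hclaw : {c, x, y, z} ⊆ s) (hs : HasIntermediateValues G s) {m : ℕ} (hm : #s = m + 1)
    {v w : V} (hv : v ∉ s) (hw : w ∈ s) (hvw : G.Adj v w) :
    (harmonic m : ℝ) + 1 / m ≤ ∑ u ∈ s, (1 : ℝ) / G.dist v u := by
  refine harmonic_add_inv_le_sum_inv (G.dist v) s m hm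
    (fun a ha => hG.pos_dist_of_ne (fun hva => hv (hva ▸ ha))) (fun a ha j hj hja => ?_) ?_
  · refine hs (G.dist v) (dist_le_dist_add_one hG v) w hw a ha j ?_ hja
    rwa [dist_eq_one_iff_adj.mpr hvw]
  · obtain ⟨a, ha, b, hb, hab⟩ := h.exists_dist_eq hG v
    exact ⟨a, hclaw ha, b, hclaw hb, hab⟩

/-- A connected vertex set containing a claw can be grown vertex by vertex, each new vertex
contributing at least as much as the end vertex of the long leg of a broom. -/
theorem IsClaw.exists_broomValue_le [Fintype V] (hG : G.Connected) (h : IsClaw G c x y z) (k : ℕ)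
    (hk : k + 4 ≤ Fintype.card V) :
    ∃ s : Finset V, #s = k + 4 ∧ {c, x, y, z} ⊆ s ∧ HasIntermediateValues G s ∧
      broomValue k ≤ hararyOn G s := by
  induction k with
  | zero => exact ⟨_, h.card_eq, subset_rfl, h.hasIntermediateValues, h.le_hararyOn hG⟩
  | succ k ih =>
    obtain ⟨s, hcard, hclaw, hs, hle⟩ := ih (by omega)
    obtain ⟨u, hu⟩ : ∃ u, u ∉ s := by
      by_contra! hall
      have := Finset.card_univ (α := V)
      rw [← Finset.eq_univ_iff_forall.mpr hall] at this
      omega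
    obtain ⟨p⟩ := hG.preconnected c u
    obtain ⟨d, -, hw, hv⟩ := p.exists_boundary_dart s (hclaw (by simp)) hu
    refine ⟨insert d.snd s, ?_, hclaw.trans (subset_insert _ _), hs.insert hw d.adj.symm, ?_⟩
    · rw [card_insert_of_notMem hv, hcard]
    · rw [hararyOn_insert G hv, broomValue]
      have := h.harmonic_le_sum_inv_dist hG hclaw hs (m := k + 3) hcard hv hw d.adj.symm
      linarith

theorem IsClaw.broomValue_le_harary [Fintype V] (hG : G.Connected) (h : IsClaw G c x y z) {k : ℕ}
    (hk : Fintype.card V = k + 4) : broomValue k / 2 ≤ harary G := by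
  obtain ⟨s, hcard, -, -, hle⟩ := h.exists_broomValue_le hG k hk.ge
  rw [harary_eq_hararyOn, ← (Finset.card_eq_iff_eq_univ s).mp (hcard.trans hk.symm)]
  linarith

end Claw

section Path

variable {V : Type*} {G : SimpleGraph V}

theorem exists_adj_dist_eq_of_dist_eq_succ_s19 (hG : G.Connected) {v a : V} {m : ℕ}
    (ha : G.dist v a = m + 1) : ∃ b, G.Adj b a ∧ G.dist v b = m := by
  obtain ⟨p, hp⟩ := hG.exists_walk_length_eq_dist a v
  rw [dist_comm, ha] at hp
  cases p with
  | nil => simp at hp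
  | cons hadj q =>
    rename_i b
    rw [Walk.length_cons] at hp
    have h₁ := dist_le q
    have h₂ := dist_le_dist_add_one hG v b a hadj.symm
    rw [dist_comm] at h₁
    exact ⟨b, hadj.symm, by omega⟩

/-- In a connected graph without claws, distinct vertices have distinct distances to a vertex
with a unique neighbour. -/
theorem dist_injective_of_forall_not_isClaw (hG : G.Connected)
    (hclaw : ∀ c x y z, ¬ IsClaw G c x y z) {v : V}
    (hv : ∀ a b, G.Adj v a → G.Adj v b → a = b) : Function.Injective (G.dist v) := by
  suffices h : ∀ m a b, G.dist v a = m → G.dist v b = m → a = b from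
    fun a b hab => h _ a b hab rfl
  intro m
  induction m with
  | zero =>
    intro a b ha hb
    exact (hG.dist_eq_zero_iff.mp ha).symm.trans (hG.dist_eq_zero_iff.mp hb)
  | succ m ih =>
    intro a b ha hb
    obtain ⟨a', haa', ha'⟩ := exists_adj_dist_eq_of_dist_eq_succ_s19 hG ha
    obtain ⟨b', hbb', hb'⟩ := exists_adj_dist_eq_of_dist_eq_succ_s19 hG hb
    obtain rfl := ih a' b' ha' hb'
    cases m with
    | zero =>
      obtain rfl := hG.dist_eq_zero_iff.mp ha'
      exact hv a b haa' hbb'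
    | succ m =>
      obtain ⟨q, hq, hqm⟩ := exists_adj_dist_eq_of_dist_eq_succ_s19 hG ha'
      by_contra hab
      refine hclaw a' q a b ⟨hq.symm, haa', hbb', ?_, ?_, hab⟩ <;> rintro rfl <;> omega

theorem nonempty_iso_pathG_of_dist_injective [Fintype V] (hG : G.Connected) {v : V}
    (hv : Function.Injective (G.dist v)) : Nonempty (G ≃g pathG (Fintype.card V)) := by
  have hlt : ∀ a, G.dist v a < Fintype.card V := fun a => by
    obtain ⟨p, hp, hlen⟩ := hG.exists_path_of_dist v a
    exact hlen ▸ hp.length_lt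
  let φ : V → Fin (Fintype.card V) := fun a => ⟨G.dist v a, hlt a⟩
  have hφ : Function.Bijective φ := by
    rw [Fintype.bijective_iff_injective_and_card, Fintype.card_fin]
    exact ⟨fun a b hab => hv (Fin.mk.inj hab), rfl⟩
  have succ_adj : ∀ a b, G.dist v b = G.dist v a + 1 → G.Adj a b := fun a b hab => by
    obtain ⟨a', hadj, ha'⟩ := exists_adj_dist_eq_of_dist_eq_succ_s19 hG hab
    exact hv ha' ▸ hadj
  refine ⟨⟨Equiv.ofBijective φ hφ, fun {a b} => ?_⟩⟩
  simp only [pathG, fromRel_adj, Equiv.ofBijective_apply]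
  constructor
  · rintro ⟨-, h | h⟩
    · exact succ_adj a b h
    · exact (succ_adj b a h).symm
  · intro hadj
    refine ⟨fun h => hadj.ne (hφ.1 h), ?_⟩
    have h₁ := dist_le_dist_add_one hG v a b hadj
    have h₂ := dist_le_dist_add_one hG v b a hadj.symm
    have h₃ := hv.ne hadj.ne
    simp only [φ]
    omega

theorem exists_isClaw_of_not_path [Fintype V] [Nontrivial V] (hG : G.IsTree)
    (hpath : ¬ Nonempty (G ≃g pathG (Fintype.card V))) : ∃ c x y z, IsClaw G c x y z := by
  classical
  by_contra! hclaw
  obtain ⟨v, hv⟩ := hG.exists_vert_degree_one_of_nontrivial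
  obtain ⟨w, -, hw⟩ := degree_eq_one_iff_existsUnique_adj.mp hv
  exact hpath (nonempty_iso_pathG_of_dist_injective hG.1
    (dist_injective_of_forall_not_isClaw hG.1 hclaw
      fun a b ha hb => (hw a ha).trans (hw b hb).symm))

end Path

section Broom

/-- A function changing by at most one along edges bounds the distance from below. -/
theorem natDist_le_dist {V : Type*} {G : SimpleGraph V} {f : V → ℕ}
    (hf : ∀ a b, G.Adj a b → f b ≤ f a + 1) {a b : V} (hab : G.Reachable a b) :
    Nat.dist (f a) (f b) ≤ G.dist a b := by
  obtain ⟨p, hp⟩ := hab.exists_walk_length_eq_dist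
  rw [← hp]
  clear hp
  induction p with
  | nil => simp
  | cons h q ih =>
    have h₁ := hf _ _ h
    have h₂ := hf _ _ h.symm
    have h₃ := ih ⟨q⟩
    rw [Walk.length_cons]
    simp only [Nat.dist] at *
    omega

theorem inv_dist_le_inv_natDist {V : Type*} {G : SimpleGraph V} {f : V → ℕ}
    (hf : ∀ a b, G.Adj a b → f b ≤ f a + 1) {a b : V} (hab : f a ≠ f b) :
    (1 : ℝ) / G.dist a b ≤ 1 / Nat.dist (f a) (f b) := by
  by_cases h : G.Reachable a b
  · apply one_div_le_one_div_of_le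
    · exact_mod_cast Nat.dist_pos_of_ne hab
    · exact_mod_cast natDist_le_dist hf h
  · rw [dist_eq_zero_of_not_reachable h]
    simp

theorem inv_dist_le_half {V : Type*} {G : SimpleGraph V} {a b : V} (hab : ¬ G.Adj a b) :
    (1 : ℝ) / G.dist a b ≤ 1 / 2 := by
  rcases Nat.eq_zero_or_pos (G.dist a b) with h | h
  · simp [h]
  · have : G.dist a b ≠ 1 := fun h₁ => hab (dist_eq_one_iff_adj.mp h₁)
    apply one_div_le_one_div_of_le two_pos
    exact_mod_cast (by omega : 2 ≤ G.dist a b)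

theorem sum_inv_natDist_range (m : ℕ) :
    ∑ j ∈ range m, (1 : ℝ) / Nat.dist m j = harmonic m := by
  rw [← Finset.sum_range_reflect, harmonic]
  push_cast
  refine Finset.sum_congr rfl fun j hj => ?_
  have hj := Finset.mem_range.mp hj
  rw [one_div]
  congr 1
  have : Nat.dist m (m - 1 - j) = j + 1 := by simp only [Nat.dist]; omega
  exact_mod_cast this

theorem broomValue_eq (k : ℕ) :
    broomValue k = 1 + 2 * ∑ j ∈ range (k + 3), (1 : ℝ) / Nat.dist 0 j +
      ∑ i ∈ range (k + 3), ∑ j ∈ range (k + 3), (1 : ℝ) / Nat.dist i j := by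
  induction k with
  | zero => norm_num [broomValue, Finset.sum_range_succ, Nat.dist]
  | succ k ih =>
    have h₁ := sum_inv_natDist_range (k + 3)
    have h₂ : ∑ i ∈ range (k + 3), (1 : ℝ) / Nat.dist i (k + 3) = harmonic (k + 3) := by
      simpa only [Nat.dist_comm _ (k + 3)] using h₁
    rw [broomValue, ih, show k + 1 + 3 = k + 3 + 1 by ring]
    simp only [Finset.sum_range_succ _ (k + 3), Finset.sum_add_distrib, h₁, h₂, Nat.dist_self]
    have h₃ : Nat.dist 0 (k + 3) = k + 3 := by simp [Nat.dist]
    rw [h₃]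
    simp only [Nat.cast_zero, div_zero]
    ring

/-- The height of a vertex of the broom `B_{k+4,3}` above the two legs of length one. -/
def broomHeight (k : ℕ) : Option (Σ i : Fin 3, Fin (broomLegs (k + 4) 3 i)) → ℕ
  | none => 1
  | some ⟨i, j⟩ => if i = 0 then j + 2 else 0

theorem broomHeight_le (k : ℕ) (a b : Option (Σ i : Fin 3, Fin (broomLegs (k + 4) 3 i)))
    (hab : (broom (k + 4) 3).Adj a b) : broomHeight k b ≤ broomHeight k a + 1 := by
  simp only [broom, spider, fromRel_adj] at hab
  obtain ⟨-, (⟨i, j, rfl, rfl, h⟩ | ⟨i, j, j', rfl, rfl, h⟩) |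
    (⟨i, j, rfl, rfl, h⟩ | ⟨i, j, j', rfl, rfl, h⟩)⟩ := hab <;>
  simp only [broomHeight] <;> split_ifs <;> omega

theorem sum_comp_broomHeight (k : ℕ) (f : ℕ → ℝ) :
    ∑ a, f (broomHeight k a) = f 0 + ∑ j ∈ range (k + 3), f j := by
  rw [Fintype.sum_option, Fintype.sum_sigma, Fin.sum_univ_three]
  have h₀ : ∑ j : Fin (broomLegs (k + 4) 3 0), f (broomHeight k (some ⟨0, j⟩)) =
      ∑ j ∈ range (k + 1), f (j + 2) := (Finset.sum_range fun j => f (j + 2)).symm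
  have h₁ : ∑ j : Fin (broomLegs (k + 4) 3 1), f (broomHeight k (some ⟨1, j⟩)) = f 0 :=
    Fin.sum_univ_one fun _ => f 0
  have h₂ : ∑ j : Fin (broomLegs (k + 4) 3 2), f (broomHeight k (some ⟨2, j⟩)) = f 0 :=
    Fin.sum_univ_one fun _ => f 0
  rw [h₀, h₁, h₂, Finset.sum_range_succ' _ (k + 2), Finset.sum_range_succ' _ (k + 1)]
  simp only [broomHeight]
  ring

/-- The vertex of a leg of length one of the broom `B_{k+4,3}`. -/
def broomLeaf (k : ℕ) (i : Fin 3) (hi : i ≠ 0) :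
    Option (Σ i : Fin 3, Fin (broomLegs (k + 4) 3 i)) :=
  some ⟨i, ⟨0, by simp [broomLegs, hi]⟩⟩

theorem eq_broomLeaf_of_ne {k : ℕ} {i : Fin 3} (hi : i ≠ 0) (j : Fin (broomLegs (k + 4) 3 i)) :
    some ⟨i, j⟩ = broomLeaf k i hi := by
  have hj := j.isLt
  simp only [broomLegs, Fin.val_eq_zero_iff, hi, if_false] at hj
  have : j = ⟨0, by simp [broomLegs, hi]⟩ := Fin.ext (by simpa using hj)
  rw [broomLeaf, this]

theorem eq_broomLeaf_of_broomHeight_eq {k : ℕ}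
    {a b : Option (Σ i : Fin 3, Fin (broomLegs (k + 4) 3 i))}
    (hab : a ≠ b) (h : broomHeight k a = broomHeight k b) :
    (a = broomLeaf k 1 (by decide) ∧ b = broomLeaf k 2 (by decide)) ∨
      (a = broomLeaf k 2 (by decide) ∧ b = broomLeaf k 1 (by decide)) := by
  rcases a with _ | ⟨i, j⟩ <;> rcases b with _ | ⟨i', j'⟩
  · exact absurd rfl hab
  · simp only [broomHeight] at h
    split_ifs at h
    omega
  · simp only [broomHeight] at h
    split_ifs at h
    omega
  · by_cases hi : i = 0 <;> by_cases hi' : i' = 0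
    · subst hi hi'
      simp only [broomHeight, if_true, Nat.add_right_cancel_iff] at h
      exact absurd (by rw [Fin.ext h]) hab
    · simp [broomHeight, hi, hi'] at h
    · simp [broomHeight, hi, hi'] at h
    · rw [eq_broomLeaf_of_ne hi, eq_broomLeaf_of_ne hi'] at hab ⊢
      fin_cases i <;> fin_cases i' <;> simp at hi hi' hab ⊢

theorem not_adj_of_broomHeight_eq {k : ℕ}
    {a b : Option (Σ i : Fin 3, Fin (broomLegs (k + 4) 3 i))}
    (h : broomHeight k a = broomHeight k b) : ¬ (broom (k + 4) 3).Adj a b := by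
  intro hab
  simp only [broom, spider, fromRel_adj] at hab
  obtain ⟨-, (⟨i, j, rfl, rfl, hj⟩ | ⟨i, j, j', rfl, rfl, hj⟩) |
    (⟨i, j, rfl, rfl, hj⟩ | ⟨i, j, j', rfl, rfl, hj⟩)⟩ := hab <;>
  simp only [broomHeight] at h <;> split_ifs at h with hi <;> try omega
  all_goals
    have h₁ := j.isLt
    have h₂ := j'.isLt
    simp only [broomLegs, Fin.val_eq_zero_iff, hi, if_false] at h₁ h₂
    omega

theorem harary_broom_le_s19 (k : ℕ) : harary (broom (k + 4) 3) ≤ broomValue k / 2 := by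
  classical
  rw [harary_eq_hararyOn, hararyOn]
  refine div_le_div_of_nonneg_right ?_ two_pos.le
  set l₁ := broomLeaf k 1 (by decide) with hl₁
  set l₂ := broomLeaf k 2 (by decide) with hl₂
  have hne : l₁ ≠ l₂ := by
    simp [hl₁, hl₂, broomLeaf]
  calc ∑ a, ∑ b, (1 : ℝ) / (broom (k + 4) 3).dist a b
      ≤ ∑ a, ∑ b, ((1 : ℝ) / Nat.dist (broomHeight k a) (broomHeight k b) +
          ((if a = l₁ then if b = l₂ then 1 / 2 else 0 else 0) +
            if a = l₂ then if b = l₁ then 1 / 2 else 0 else 0)) := by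
        refine Finset.sum_le_sum fun a _ => Finset.sum_le_sum fun b _ => ?_
        by_cases h : broomHeight k a = broomHeight k b
        · rw [h, Nat.dist_self, Nat.cast_zero, div_zero, zero_add]
          by_cases hab : a = b
          · rw [hab, dist_self, Nat.cast_zero, div_zero]
            positivity
          · refine (inv_dist_le_half (not_adj_of_broomHeight_eq h)).trans ?_
            rcases eq_broomLeaf_of_broomHeight_eq hab h with ⟨rfl, rfl⟩ | ⟨rfl, rfl⟩
            · simp [← hl₁, ← hl₂, hne]
            · simp [← hl₁, ← hl₂, hne.symm]
        · exact (inv_dist_le_inv_natDist (broomHeight_le k) h).trans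
            (le_add_of_nonneg_right (by positivity))
    _ = broomValue k := by
        have hsum := (Finset.sum_congr rfl fun a _ => sum_comp_broomHeight k fun j =>
          (1 : ℝ) / Nat.dist (broomHeight k a) j).trans
            (sum_comp_broomHeight k fun i =>
              (1 : ℝ) / Nat.dist i 0 + ∑ j ∈ range (k + 3), (1 : ℝ) / Nat.dist i j)
        simp only [Finset.sum_add_distrib]
        rw [hsum, broomValue_eq, Finset.sum_add_distrib]
        simp only [Nat.dist_comm _ 0, Nat.dist_self, Nat.cast_zero, div_zero,
          ← Finset.ite_sum_zero, Finset.sum_ite_eq', Finset.mem_univ, if_true]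
        ring

end Broom

theorem harary_second_min {V : Type*} [Fintype V] (T : SimpleGraph V) (hT : T.IsTree)
    (n : ℕ) (hn : 4 ≤ n) (hcard : Fintype.card V = n)
    (hTP : ¬ Nonempty (T ≃g pathG n)) :
    harary (broom n 3) ≤ harary T := by
  classical
  subst hcard
  obtain ⟨k, hk⟩ := Nat.exists_eq_add_of_le' hn
  have : Nontrivial V := Fintype.one_lt_card_iff_nontrivial.mp (by omega)
  obtain ⟨c, x, y, z, h⟩ := exists_isClaw_of_not_path hT hTP
  rw [hk]
  exact (harary_broom_le_s19 k).trans (h.broomValue_le_harary hT.1 hk)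
end
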